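/- Non-existence of stationary states on the star graph in the defocusing case: let p ∈ (2,6), α < 0, λ ∈ ℝ, N ≥ 3, and 0 < μ ≤ μ_ℝ where μ_ℝ = π√3/2. Let u₁, …, u_N : [0,∞) → ℝ be functions, each continuously differentiable on [0,∞) and twice differentiable on (0,∞), with u_i and u_i′ square-integrable on (0,∞), u_i(x) → 0 and u_i′(x) → 0 as x → ∞, satisfying u₁(0) = ⋯ = u_N(0), the Kirchhoff condition Σ_{i=1}^N u_i′(0) = 0, the mass constraint Σ_{i=1}^N ∫₀^∞ u_i² dx = μ, and the stationary NLS equation −u_i″ + λ u_i = |u_i|⁴ u_i + α |u_i|^{p−2} u_i on (0,∞) for every i. Then u_i ≡ 0 for every i; in other words, no such nontrivial stationary state exists. -/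

import Mathlib

open MeasureTheory Real Set Filter

/-- A differentiable function whose derivative is controlled by the function itself, either
vanishes at both ends of an interval or at none of them. -/
theorem eq_zero_iff_of_sq_deriv_le {f f' : ℝ → ℝ} {y C : ℝ} (hy : 0 ≤ y) (hC : 0 ≤ C)
    (hf : ContinuousOn f (Icc 0 y)) (hf' : ∀ x ∈ Ioo 0 y, HasDerivAt f (f' x) x)
    (hle : ∀ x ∈ Ioo 0 y, (f' x) ^ 2 ≤ C ^ 2 * (f x) ^ 2) :
    f 0 = 0 ↔ f y = 0 := by
  have key : ∀ x ∈ Ioo 0 y, |f x * f' x| ≤ C * (f x) ^ 2 := by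
    intro x hx
    have h1 : |f' x| ≤ C * |f x| := by
      apply abs_le_of_sq_le_sq' _ (by positivity) |> abs_le.mpr
      rw [mul_pow, sq_abs]
      exact hle x hx
    rw [abs_mul, ← sq_abs (f x)]
    nlinarith [abs_nonneg (f x)]
  have hd : ∀ K : ℝ, ∀ x ∈ Ioo 0 y, HasDerivAt (fun x => (f x) ^ 2 * exp (K * x))
      ((2 * (f x * f' x) + K * (f x) ^ 2) * exp (K * x)) x := by
    intro K x hx
    have h1 := (hf' x hx).pow 2
    have h2 := ((hasDerivAt_id x).const_mul K).exp
    refine (h1.mul h2).congr_deriv ?_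
    simp
    ring
  have hc : ∀ K : ℝ, ContinuousOn (fun x => (f x) ^ 2 * exp (K * x)) (Icc 0 y) := by
    intro K
    fun_prop
  constructor
  · intro h0
    have hanti : AntitoneOn (fun x => (f x) ^ 2 * exp ((-2 * C) * x)) (Icc 0 y) := by
      apply antitoneOn_of_hasDerivWithinAt_nonpos (convex_Icc 0 y) (hc _)
        (f' := fun x => (2 * (f x * f' x) + (-2 * C) * (f x) ^ 2) * exp ((-2 * C) * x))
      · intro x hx
        rw [interior_Icc] at hx
        exact (hd _ x hx).hasDerivWithinAt
      · intro x hx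
        rw [interior_Icc] at hx
        have := (abs_le.1 (key x hx)).2
        exact mul_nonpos_of_nonpos_of_nonneg (by linarith) (exp_pos _).le
    have := hanti (left_mem_Icc.2 hy) (right_mem_Icc.2 hy) hy
    simp only [h0] at this
    have h2 := exp_pos ((-2 * C) * y)
    have : (f y) ^ 2 ≤ 0 := by
      by_contra! h
      have := mul_pos h h2
      linarith
    exact pow_eq_zero_iff two_ne_zero |>.1 (le_antisymm this (sq_nonneg _))
  · intro h0
    have hmono : MonotoneOn (fun x => (f x) ^ 2 * exp ((2 * C) * x)) (Icc 0 y) := by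
      apply monotoneOn_of_hasDerivWithinAt_nonneg (convex_Icc 0 y) (hc _)
        (f' := fun x => (2 * (f x * f' x) + (2 * C) * (f x) ^ 2) * exp ((2 * C) * x))
      · intro x hx
        rw [interior_Icc] at hx
        exact (hd _ x hx).hasDerivWithinAt
      · intro x hx
        rw [interior_Icc] at hx
        have := (abs_le.1 (key x hx)).1
        exact mul_nonneg (by linarith) (exp_pos _).le
    have := hmono (left_mem_Icc.2 hy) (right_mem_Icc.2 hy) hy
    simp only [h0, mul_zero, exp_zero, mul_one] at this
    have : (f 0) ^ 2 ≤ 0 := by simpa using this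
    exact pow_eq_zero_iff two_ne_zero |>.1 (le_antisymm this (sq_nonneg _))

/-- Conservation of energy for solutions of the stationary equation decaying at infinity. -/
theorem sq_deriv_eq_of_stationary {p α lam : ℝ} (hp : 2 < p) {u u' u'' : ℝ → ℝ}
    (hderiv : ∀ x ∈ Ici (0 : ℝ), HasDerivWithinAt u (u' x) (Ici 0) x)
    (hderivCont : ContinuousOn u' (Ici 0))
    (hderiv2 : ∀ x ∈ Ioi (0 : ℝ), HasDerivAt u' (u'' x) x)
    (hu0 : Tendsto u atTop (nhds 0)) (hu'0 : Tendsto u' atTop (nhds 0))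
    (heq : ∀ x ∈ Ioi (0 : ℝ),
      -(u'' x) + lam * u x = |u x| ^ 4 * u x + α * |u x| ^ (p - 2) * u x) :
    ∀ x ∈ Ici (0 : ℝ),
      (u' x) ^ 2 = (u x) ^ 2 * (lam + -(2 * α / p) * |u x| ^ (p - 2) - (u x) ^ 4 / 3) := by
  have hp0 : 0 < p := by linarith
  let H : ℝ → ℝ := fun x => (u' x) ^ 2 - lam * (u x) ^ 2 + (u x) ^ 6 / 3 + 2 * α / p * |u x| ^ p
  have hcu : ContinuousOn u (Ici 0) := fun x hx => (hderiv x hx).continuousWithinAt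
  have hHc : ContinuousOn H (Ici 0) := by
    have : ContinuousOn (fun x => |u x| ^ p) (Ici 0) :=
      hcu.abs.rpow_const fun x _ => Or.inr hp0.le
    fun_prop
  have hHd : ∀ x ∈ Ioi (0 : ℝ), HasDerivAt H 0 x := by
    intro x hx
    have h1 : HasDerivAt u (u' x) x :=
      (hderiv x (mem_Ici.2 (mem_Ioi.1 hx).le)).hasDerivAt (Ici_mem_nhds hx)
    have h2 := (hasDerivAt_abs_rpow (u x) (p := p) (by linarith)).comp x h1
    have h3 := ((((hderiv2 x hx).pow 2).sub ((h1.pow 2).const_mul lam)).add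
      ((h1.pow 6).div_const 3)).add (h2.const_mul (2 * α / p))
    refine h3.congr_deriv ?_
    have he := heq x hx
    have h4 : |u x| ^ 4 = u x ^ 4 := by
      rw [show (4 : ℕ) = 2 * 2 from rfl, pow_mul, sq_abs, pow_mul]
    rw [h4] at he
    have h5 : u'' x = lam * u x - (u x ^ 4 * u x + α * |u x| ^ (p - 2) * u x) := by linarith
    rw [h5]
    field_simp
    push_cast
    ring
  have hHt : Tendsto H atTop (nhds 0) := by
    have h1 : Tendsto (fun x => |u x| ^ p) atTop (nhds 0) := by
      have := (hu0.abs).rpow_const (p := p) (Or.inr hp0.le)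
      simpa [zero_rpow hp0.ne'] using this
    have := (((hu'0.pow 2).sub ((hu0.pow 2).const_mul lam)).add
      ((hu0.pow 6).div_const 3)).add (h1.const_mul (2 * α / p))
    simpa using this
  intro x hx
  have hconst : ∀ y ∈ Ici x, H y = H x := by
    intro y hy
    have hy0 : y ∈ Ici (0 : ℝ) := mem_Ici.2 (le_trans hx hy)
    have hd : ∀ z ∈ interior (Ici (0 : ℝ)), HasDerivWithinAt H 0 (interior (Ici 0)) z := by
      intro z hz
      rw [interior_Ici] at hz
      exact (hHd z hz).hasDerivWithinAt
    exact le_antisymm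
      (antitoneOn_of_hasDerivWithinAt_nonpos (convex_Ici 0) hHc hd (fun _ _ => le_rfl) hx hy0 hy)
      (monotoneOn_of_hasDerivWithinAt_nonneg (convex_Ici 0) hHc hd (fun _ _ => le_rfl) hx hy0 hy)
  have hH : H x = 0 := by
    refine tendsto_nhds_unique (tendsto_const_nhds.congr' ?_) hHt
    filter_upwards [eventually_ge_atTop x] with y hy
    exact (hconst y hy).symm
  have hpow : |u x| ^ p = |u x| ^ (p - 2) * (u x) ^ 2 := by
    rw [← sq_abs (u x), ← rpow_natCast |u x| 2, ← rpow_add' (abs_nonneg _) (by simp; linarith)]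
    simp
  simp only [H, hpow] at hH
  linear_combination hH

theorem le_of_potential_nonneg {lam c q s m : ℝ} (hlam : 0 ≤ lam) (hq : 0 < q) (hq' : q < 4)
    (hm : 0 < m) (hzero : lam + c * m ^ q - m ^ 4 / 3 = 0)
    (hs : 0 ≤ lam + c * s ^ q - s ^ 4 / 3) : s ≤ m := by
  by_contra! h
  have ht : 1 < s / m := (one_lt_div hm).2 h
  obtain ⟨t, rfl⟩ : ∃ t, s = t * m := ⟨s / m, by field_simp⟩
  rw [mul_div_cancel_right₀ _ hm.ne'] at ht
  have h1 : t ^ q < t ^ 4 := by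
    rw [← rpow_natCast t 4]
    exact rpow_lt_rpow_of_exponent_lt ht (by exact_mod_cast hq')
  have h2 : 1 < t ^ q := one_lt_rpow ht hq
  rw [mul_rpow (by linarith) hm.le, mul_pow] at hs
  have h3 : c * m ^ q = m ^ 4 / 3 - lam := by linarith
  have h4 : lam + t ^ q * (m ^ 4 / 3 - lam) - t ^ 4 * m ^ 4 / 3 ≥ 0 := by
    rw [← h3]; linarith
  have h5 : 0 < m ^ 4 := by positivity
  nlinarith [mul_pos (sub_pos.2 h1) h5, mul_nonneg hlam (sub_pos.2 h2).le]

theorem potential_le {lam c q s m : ℝ} (hc : 0 ≤ c) (hq : 0 < q) (hs : 0 ≤ s) (hsm : s ≤ m)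
    (hzero : lam + c * m ^ q - m ^ 4 / 3 = 0) :
    lam + c * s ^ q - s ^ 4 / 3 ≤ (m ^ 4 - s ^ 4) / 3 := by
  have := mul_le_mul_of_nonneg_left (rpow_le_rpow hs hsm hq.le) hc
  linarith

theorem abs_arcsin_sub_le_integral_sq {u u' : ℝ → ℝ} {m : ℝ} (hm : 0 < m)
    (hderiv : ∀ x ∈ Ici (0 : ℝ), HasDerivWithinAt u (u' x) (Ici 0) x)
    (hum : ∀ x ∈ Ici (0 : ℝ), |u x| ≤ m)
    (hu' : ∀ x ∈ Ici (0 : ℝ), (u' x) ^ 2 ≤ (u x) ^ 2 * ((m ^ 4 - (u x) ^ 4) / 3))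
    {x y : ℝ} (hx : 0 ≤ x) (hxy : x ≤ y) :
    |arcsin ((u y) ^ 2 / m ^ 2) - arcsin ((u x) ^ 2 / m ^ 2)| * (√3 / 2)
      ≤ ∫ t in x..y, (u t) ^ 2 := by
  have hcu : ContinuousOn u (Ici 0) := fun x hx => (hderiv x hx).continuousWithinAt
  have hIcc : Icc x y ⊆ Ici 0 := fun z hz => hx.trans hz.1
  have h3 : (0 : ℝ) < √3 := by positivity
  have h3' : √3 ^ 2 = 3 := sq_sqrt (by norm_num)
  have hM : ∀ M, m < M → |arcsin ((u y) ^ 2 / M ^ 2) - arcsin ((u x) ^ 2 / M ^ 2)| * (√3 / 2)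
      ≤ ∫ t in x..y, (u t) ^ 2 := by
    intro M hmM
    have hM0 : 0 < M := hm.trans hmM
    let G' : ℝ → ℝ := fun t => 1 / √(1 - ((u t) ^ 2 / M ^ 2) ^ 2) * (2 * u t * u' t / M ^ 2)
    have hGc : ContinuousOn (fun t => arcsin ((u t) ^ 2 / M ^ 2)) (Icc x y) :=
      continuous_arcsin.comp_continuousOn (((hcu.mono hIcc).pow 2).div_const _)
    have hlt : ∀ t ∈ Ici (0 : ℝ), (u t) ^ 2 < M ^ 2 := fun t ht => by
      rw [sq_lt_sq, abs_of_pos hM0]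
      exact (hum t ht).trans_lt hmM
    have hGd : ∀ t ∈ Ioo x y, HasDerivWithinAt (fun t => arcsin ((u t) ^ 2 / M ^ 2))
        (G' t) (Ioi t) t := by
      intro t ht
      have ht0 : 0 < t := hx.trans_lt ht.1
      have h1 : HasDerivAt u (u' t) t := (hderiv t ht0.le).hasDerivAt (Ici_mem_nhds ht0)
      have h2 : (u t) ^ 2 / M ^ 2 < 1 := (div_lt_one (by positivity)).2 (hlt t ht0.le)
      have h2' : 0 ≤ (u t) ^ 2 / M ^ 2 := by positivity
      have h4 := (hasDerivAt_arcsin (x := (u t) ^ 2 / M ^ 2) (by linarith) h2.ne).comp t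
        ((h1.pow 2).div_const (M ^ 2))
      refine (h4.congr_deriv ?_).hasDerivWithinAt
      simp [G']
    have hG' : ∀ t ∈ Ioo x y, |G' t| ≤ 2 / √3 * (u t) ^ 2 := by
      intro t ht
      have ht0 : (0 : ℝ) ≤ t := (hx.trans_lt ht.1).le
      have hl := hlt t ht0
      have hpos : 0 < M ^ 4 - (u t) ^ 4 := by nlinarith [sq_nonneg (u t)]
      have hpos' : 0 < 1 - ((u t) ^ 2 / M ^ 2) ^ 2 := by
        have : 1 - ((u t) ^ 2 / M ^ 2) ^ 2 = (M ^ 4 - (u t) ^ 4) / M ^ 4 := by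
          field_simp
        rw [this]; positivity
      apply abs_le_of_sq_le_sq _ (by positivity)
      simp only [G']
      rw [mul_pow, div_pow, sq_sqrt hpos'.le, mul_pow, div_pow 2, h3']
      have h6 : 1 ^ 2 / (1 - ((u t) ^ 2 / M ^ 2) ^ 2) * (2 * u t * u' t / M ^ 2) ^ 2
          = 4 * (u t) ^ 2 * (u' t) ^ 2 / (M ^ 4 - (u t) ^ 4) := by
        field_simp
        ring
      rw [h6, div_le_iff₀ hpos]
      have h7 : m ^ 4 ≤ M ^ 4 := pow_le_pow_left₀ hm.le hmM.le 4
      have h8 : (u' t) ^ 2 ≤ (u t) ^ 2 * ((M ^ 4 - (u t) ^ 4) / 3) :=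
        (hu' t ht0).trans (by gcongr)
      have := mul_le_mul_of_nonneg_left h8 (by positivity : 0 ≤ 4 * (u t) ^ 2)
      linarith
    have hint : IntegrableOn (fun t => 2 / √3 * (u t) ^ 2) (Icc x y) :=
      (continuousOn_const.mul ((hcu.mono hIcc).pow 2)).integrableOn_Icc
    have hup := intervalIntegral.sub_le_integral_of_hasDeriv_right_of_le hxy hGc hGd hint
      fun t ht => (abs_le.1 (hG' t ht)).2
    have hlo := intervalIntegral.integral_le_sub_of_hasDeriv_right_of_le hxy hGc hGd hint.neg
      fun t ht => (abs_le.1 (hG' t ht)).1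
    simp only [Pi.neg_apply, intervalIntegral.integral_neg,
      intervalIntegral.integral_const_mul] at hup hlo
    have habs := abs_le.2 ⟨hlo, hup⟩
    calc _ ≤ 2 / √3 * (∫ t in x..y, (u t) ^ 2) * (√3 / 2) := by gcongr
      _ = _ := by field_simp
  have hlim : ∀ z, Tendsto (fun M => arcsin ((u z) ^ 2 / M ^ 2)) (nhdsWithin m (Ioi m))
      (nhds (arcsin ((u z) ^ 2 / m ^ 2))) := by
    intro z
    refine Tendsto.mono_left ?_ nhdsWithin_le_nhds
    refine (continuous_arcsin.tendsto _).comp ?_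
    exact tendsto_const_nhds.div (tendsto_id.pow 2) (by positivity)
  refine le_of_tendsto (((hlim y).sub (hlim x)).abs.mul_const (√3 / 2)) ?_
  filter_upwards [self_mem_nhdsWithin] with M hMm using hM M hMm

theorem arcsin_le_integral_Ioi_sq {u u' : ℝ → ℝ} {m : ℝ} (hm : 0 < m)
    (hderiv : ∀ x ∈ Ici (0 : ℝ), HasDerivWithinAt u (u' x) (Ici 0) x)
    (hum : ∀ x ∈ Ici (0 : ℝ), |u x| ≤ m)
    (hu' : ∀ x ∈ Ici (0 : ℝ), (u' x) ^ 2 ≤ (u x) ^ 2 * ((m ^ 4 - (u x) ^ 4) / 3))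
    (hu2 : IntegrableOn (fun x => (u x) ^ 2) (Ioi 0)) (hu0 : Tendsto u atTop (nhds 0))
    {x : ℝ} (hx : 0 ≤ x) :
    arcsin ((u x) ^ 2 / m ^ 2) * (√3 / 2) ≤ ∫ t in Ioi x, (u t) ^ 2 := by
  have h1 : Tendsto (fun y => (arcsin ((u x) ^ 2 / m ^ 2) - arcsin ((u y) ^ 2 / m ^ 2)) * (√3 / 2))
      atTop (nhds (arcsin ((u x) ^ 2 / m ^ 2) * (√3 / 2))) := by
    have h := (continuous_arcsin.tendsto _).comp ((hu0.pow 2).div_const (m ^ 2))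
    have := (h.const_sub (arcsin ((u x) ^ 2 / m ^ 2))).mul_const (√3 / 2)
    simpa using this
  have h2 := intervalIntegral_tendsto_integral_Ioi x (hu2.mono_set (Ioi_subset_Ioi hx)) tendsto_id
  refine le_of_tendsto_of_tendsto h1 h2 ?_
  filter_upwards [eventually_ge_atTop x] with y hy
  refine le_trans ?_ (abs_arcsin_sub_le_integral_sq hm hderiv hum hu' hx hy)
  gcongr
  rw [abs_sub_comm]
  exact le_abs_self _

/-- A function vanishing at infinity but not at the origin has an interior critical point on the
half-line, unless its modulus does not increase at the origin. -/
theorem exists_deriv_eq_zero_or_mul_deriv_nonpos {u u' : ℝ → ℝ}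
    (hderiv : ∀ x ∈ Ici (0 : ℝ), HasDerivWithinAt u (u' x) (Ici 0) x)
    (hu0 : Tendsto u atTop (nhds 0)) (h0 : u 0 ≠ 0) :
    (∃ x₀, 0 < x₀ ∧ u' x₀ = 0) ∨ u 0 * u' 0 ≤ 0 := by
  have hcu : ContinuousOn u (Ici 0) := fun x hx => (hderiv x hx).continuousWithinAt
  obtain ⟨R, hR⟩ : ∃ R, ∀ x ≥ R, |u x| < |u 0| := by
    have := hu0.abs
    rw [abs_zero] at this
    exact eventually_atTop.1 (this.eventually_lt_const (abs_pos.2 h0))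
  have hne : (Icc 0 (max R 0)).Nonempty := ⟨0, by simp⟩
  obtain ⟨x₀, hx₀, hmax⟩ := isCompact_Icc.exists_isMaxOn hne
    (hcu.mono (Icc_subset_Ici_self : Icc 0 (max R 0) ⊆ Ici 0)).abs
  have hmax' : ∀ x ∈ Ici (0 : ℝ), |u x| ≤ |u x₀| := by
    intro x hx
    rcases le_total x (max R 0) with h | h
    · exact hmax ⟨hx, h⟩
    · exact (hR x ((le_max_left _ _).trans h)).le.trans (hmax (by simp))
  rcases hx₀.1.eq_or_lt with h | h
  · right
    subst h
    have h1 := (hderiv 0 self_mem_Ici).pow 2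
    have h2 : 2 * (u 0 * u' 0) ≤ 0 := by
      rw [hasDerivWithinAt_iff_tendsto_slope, Ici_sdiff_left] at h1
      have h3 := le_of_tendsto (b := 0) h1 (by
        filter_upwards [self_mem_nhdsWithin] with x hx
        rw [slope_def_field]
        apply div_nonpos_of_nonpos_of_nonneg
        · exact sub_nonpos.2 (sq_le_sq.2 (hmax' x (mem_Ici.2 (mem_Ioi.1 hx).le)))
        · simpa using le_of_lt hx)
      simpa [mul_assoc] using h3
    linarith
  · left
    refine ⟨x₀, h, ?_⟩
    have h1 := ((hderiv x₀ h.le).hasDerivAt (Ici_mem_nhds h)).pow 2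
    have h2 : IsLocalMax (u ^ 2) x₀ := by
      filter_upwards [Ici_mem_nhds h] with x hx
      exact sq_le_sq.2 (hmax' x hx)
    have h3 := h2.hasDerivAt_eq_zero h1
    have h4 : u x₀ ≠ 0 := abs_pos.1 ((abs_pos.2 h0).trans_le (hmax' 0 self_mem_Ici))
    simpa [h4] using h3


/-- Non-existence of stationary states on the star graph in the defocusing case:
for `p ∈ (2,6)`, `α < 0`, `N ≥ 3` and mass `0 < μ ≤ μ_ℝ = π√3/2`, any stationary
state `u = (u₁, …, u_N)` of the NLS equation with combined nonlinearities on the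
star graph, satisfying the matching and Kirchhoff conditions at the origin and the
mass constraint, vanishes identically on `[0,∞)`. -/
theorem no_stationary_state_star_graph_defocusing
    (p α lam μ : ℝ) (hp : 2 < p) (hp' : p < 6) (hα : α < 0)
    (hμ : 0 < μ) (hμR : μ ≤ Real.pi * Real.sqrt 3 / 2)
    (N : ℕ) (hN : 3 ≤ N)
    (u u' u'' : Fin N → ℝ → ℝ)
    -- each `uᵢ` is continuously differentiable on `[0,∞)` with derivative `uᵢ'`
    (hderiv : ∀ i, ∀ x ∈ Set.Ici (0 : ℝ), HasDerivWithinAt (u i) (u' i x) (Set.Ici 0) x)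
    (hderivCont : ∀ i, ContinuousOn (u' i) (Set.Ici 0))
    -- each `uᵢ` is twice differentiable on `(0,∞)` with second derivative `uᵢ''`
    (hderiv2 : ∀ i, ∀ x ∈ Set.Ioi (0 : ℝ), HasDerivAt (u' i) (u'' i x) x)
    -- square-integrability of `uᵢ` and `uᵢ'` on `(0,∞)`
    (hu2 : ∀ i, IntegrableOn (fun x => (u i x) ^ 2) (Set.Ioi 0))
    (hu'2 : ∀ i, IntegrableOn (fun x => (u' i x) ^ 2) (Set.Ioi 0))
    -- decay at infinity
    (hu0 : ∀ i, Filter.Tendsto (u i) Filter.atTop (nhds 0))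
    (hu'0 : ∀ i, Filter.Tendsto (u' i) Filter.atTop (nhds 0))
    -- matching condition at the common origin
    (hmatch : ∀ i j, u i 0 = u j 0)
    -- Kirchhoff condition
    (hkirchhoff : ∑ i : Fin N, u' i 0 = 0)
    -- mass constraint
    (hmass : ∑ i : Fin N, ∫ x in Set.Ioi (0 : ℝ), (u i x) ^ 2 = μ)
    -- stationary NLS equation with combined nonlinearities on each half-line
    (heq : ∀ i, ∀ x ∈ Set.Ioi (0 : ℝ),
      -(u'' i x) + lam * u i x = |u i x| ^ 4 * u i x + α * |u i x| ^ (p - 2) * u i x) :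
    ∀ i, ∀ x ∈ Set.Ici (0 : ℝ), u i x = 0 := by
  have hp0 : 0 < p := by linarith
  set c : ℝ := -(2 * α / p) with hc_def
  have hc : 0 < c := by
    rw [hc_def, neg_pos]
    exact div_neg_of_neg_of_pos (by linarith) hp0
  have hE : ∀ i, ∀ x ∈ Ici (0 : ℝ),
      (u' i x) ^ 2 = (u i x) ^ 2 * (lam + c * |u i x| ^ (p - 2) - |u i x| ^ 4 / 3) := by
    intro i x hx
    rw [Even.pow_abs (by decide)]
    exact sq_deriv_eq_of_stationary hp (hderiv i) (hderivCont i) (hderiv2 i) (hu0 i) (hu'0 i)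
      (heq i) x hx
  have hcu : ∀ i, ContinuousOn (u i) (Ici 0) :=
    fun i x hx => (hderiv i x hx).continuousWithinAt
  have hZ : ∀ i, ∀ y ∈ Ici (0 : ℝ), u i 0 = 0 ↔ u i y = 0 := by
    intro i y hy
    have hcy : ContinuousOn (u i) (Icc 0 y) := (hcu i).mono Icc_subset_Ici_self
    have hcg : ContinuousOn (fun x => lam + c * |u i x| ^ (p - 2) - |u i x| ^ 4 / 3)
        (Icc 0 y) := by
      have : ContinuousOn (fun x => |u i x| ^ (p - 2)) (Icc 0 y) :=
        hcy.abs.rpow_const fun x _ => Or.inr (by linarith)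
      fun_prop
    obtain ⟨B, hB⟩ := isCompact_Icc.exists_bound_of_continuousOn hcg
    refine eq_zero_iff_of_sq_deriv_le (f' := u' i) (C := 1 + |B|) hy (by positivity) hcy
      (fun x hx => (hderiv i x hx.1.le).hasDerivAt (Ici_mem_nhds hx.1)) fun x hx => ?_
    rw [hE i x hx.1.le, mul_comm]
    have h1 := (le_abs_self _).trans (hB x ⟨hx.1.le, hx.2.le⟩)
    gcongr
    nlinarith [le_abs_self B, abs_nonneg B]
  have i₀ : Fin N := ⟨0, by omega⟩
  by_cases ha : u i₀ 0 = 0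
  · intro i x hx
    rw [← hZ i x hx, hmatch i i₀, ha]
  exfalso
  set a := u i₀ 0 with ha_def
  have hua : ∀ i, u i 0 = a := fun i => hmatch i i₀
  have hne : ∀ i, ∀ x ∈ Ici (0 : ℝ), u i x ≠ 0 := by
    intro i x hx
    rw [Ne, ← hZ i x hx, hua]
    exact ha
  have hg : ∀ i, ∀ x ∈ Ici (0 : ℝ), 0 ≤ lam + c * |u i x| ^ (p - 2) - |u i x| ^ 4 / 3 := by
    intro i x hx
    have h1 : 0 < (u i x) ^ 2 := by have := hne i x hx; positivity
    exact nonneg_of_mul_nonneg_right (hE i x hx ▸ sq_nonneg _) h1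
  have hlam : 0 ≤ lam := by
    have h1 := (hu0 i₀).abs.rpow_const (p := p - 2) (Or.inr (by linarith))
    have h2 := ((h1.const_mul c).const_add lam).sub (((hu0 i₀).abs.pow 4).div_const 3)
    rw [abs_zero, zero_rpow (by linarith)] at h2
    have h3 := ge_of_tendsto h2 (by
      filter_upwards [eventually_ge_atTop 0] with x hx using hg i₀ x hx)
    simpa using h3
  have hcrit : ∀ i, ∀ x ∈ Ici (0 : ℝ), u' i x = 0 →
      lam + c * |u i x| ^ (p - 2) - |u i x| ^ 4 / 3 = 0 := by
    intro i x hx h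
    have h1 := hE i x hx
    rw [h, zero_pow two_ne_zero, eq_comm] at h1
    exact (mul_eq_zero.1 h1).resolve_left (pow_ne_zero 2 (hne i x hx))
  have hsum : ∑ i, a * u' i 0 = 0 := by rw [← Finset.mul_sum, hkirchhoff, mul_zero]
  have hmaxi : ∀ i, (∃ x₀, 0 < x₀ ∧ u' i x₀ = 0) ∨
      a * u' i 0 ≤ 0 := by
    intro i
    have := exists_deriv_eq_zero_or_mul_deriv_nonpos (hderiv i) (hu0 i) (hne i 0 self_mem_Ici)
    rwa [hua] at this
  obtain ⟨m, hm, hgm⟩ : ∃ m, 0 < m ∧ lam + c * m ^ (p - 2) - m ^ 4 / 3 = 0 := by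
    by_cases h : ∃ i, ∃ x₀, 0 < x₀ ∧ u' i x₀ = 0
    · obtain ⟨i, x₀, hx₀, h0⟩ := h
      exact ⟨|u i x₀|, abs_pos.2 (hne i x₀ hx₀.le), hcrit i x₀ hx₀.le h0⟩
    · push Not at h
      have h1 : ∀ i ∈ Finset.univ, a * u' i 0 ≤ 0 := fun i _ =>
        (hmaxi i).resolve_left fun ⟨x₀, h2, h3⟩ => h i x₀ h2 h3
      have h2 := (Finset.sum_eq_zero_iff_of_nonpos h1).1 hsum i₀ (Finset.mem_univ _)
      exact ⟨|u i₀ 0|, abs_pos.2 ha,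
        hcrit i₀ 0 self_mem_Ici ((mul_eq_zero.1 h2).resolve_left ha)⟩
  have hle_m : ∀ i, ∀ x ∈ Ici (0 : ℝ), |u i x| ≤ m := fun i x hx =>
    le_of_potential_nonneg hlam (by linarith) (by linarith) hm hgm (hg i x hx)
  have heq_m : ∀ i, ∀ x ∈ Ici (0 : ℝ), u' i x = 0 → (u i x) ^ 2 / m ^ 2 = 1 := by
    intro i x hx h
    have h1 : m ≤ |u i x| := le_of_potential_nonneg hlam (q := p - 2) (by linarith) (by linarith)
      (abs_pos.2 (hne i x hx)) (hcrit i x hx h) hgm.ge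
    rw [← sq_abs, le_antisymm (hle_m i x hx) h1]
    field_simp
  have hu'm : ∀ i, ∀ x ∈ Ici (0 : ℝ),
      (u' i x) ^ 2 ≤ (u i x) ^ 2 * ((m ^ 4 - (u i x) ^ 4) / 3) := by
    intro i x hx
    rw [hE i x hx]
    have := potential_le hc.le (by linarith) (abs_nonneg _) (hle_m i x hx) hgm
    rw [Even.pow_abs (by decide)] at this ⊢
    gcongr
  have htail : ∀ i, ∀ x ∈ Ici (0 : ℝ),
      arcsin ((u i x) ^ 2 / m ^ 2) * (√3 / 2) ≤ ∫ t in Ioi x, (u i t) ^ 2 := fun i x hx =>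
    arcsin_le_integral_Ioi_sq hm (hderiv i) (hle_m i) (hu'm i) (hu2 i) (hu0 i) hx
  obtain ⟨k, hk⟩ : ∃ k, ∀ i,
      (π / 2 + a * u' i 0 * k) * (√3 / 2) ≤ ∫ t in Ioi (0 : ℝ), (u i t) ^ 2 := by
    by_cases hD : u' i₀ 0 = 0
    · refine ⟨0, fun i => ?_⟩
      have h1 : a ^ 2 / m ^ 2 = 1 := heq_m i₀ 0 self_mem_Ici hD
      have h2 := htail i 0 self_mem_Ici
      rw [hua, h1, arcsin_one] at h2
      simpa using h2
    · set D := |a * u' i₀ 0| with hD_def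
      have hD0 : 0 < D := abs_pos.2 (mul_ne_zero ha hD)
      refine ⟨(π / 2 - arcsin (a ^ 2 / m ^ 2)) / D, fun i => ?_⟩
      have hsq : |a * u' i 0| = D := by
        rw [hD_def, ← sq_eq_sq_iff_abs_eq_abs, mul_pow, mul_pow, hE i 0 self_mem_Ici,
          hE i₀ 0 self_mem_Ici, hua, hua]
      have h0 := htail i 0 self_mem_Ici
      rw [hua] at h0
      rcases abs_choice (a * u' i 0) with h | h
      · have hd : a * u' i 0 = D := by rw [← h, hsq]
        rw [hd, mul_div_cancel₀ _ hD0.ne']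
        obtain ⟨x₀, hx₀, hx₀'⟩ := (hmaxi i).resolve_right (by rw [hd]; exact hD0.not_ge)
        have h1 := htail i x₀ hx₀.le
        have h2 := abs_arcsin_sub_le_integral_sq hm (hderiv i) (hle_m i) (hu'm i) le_rfl hx₀.le
        rw [heq_m i x₀ hx₀.le hx₀', arcsin_one] at h1 h2
        rw [hua] at h2
        have h3 : (π / 2 - arcsin (a ^ 2 / m ^ 2)) * (√3 / 2) ≤ ∫ t in (0 : ℝ)..x₀, (u i t) ^ 2 :=
          le_trans (by gcongr; exact le_abs_self _) h2
        have h4 := intervalIntegral.integral_interval_add_Ioi (hu2 i)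
          ((hu2 i).mono_set (Ioi_subset_Ioi hx₀.le))
        rw [← h4]
        linarith
      · have hd : a * u' i 0 = -D := by linarith
        rw [hd, neg_mul, mul_div_cancel₀ _ hD0.ne']
        linarith
  have htotal : N * (π / 2) * (√3 / 2) ≤ μ := by
    rw [← hmass]
    refine le_trans (le_of_eq ?_) (Finset.sum_le_sum fun i _ => hk i)
    rw [← Finset.sum_mul, Finset.sum_add_distrib, ← Finset.sum_mul, hsum]
    simp
  have hN' : (3 : ℝ) ≤ N := by exact_mod_cast hN
  have hpos : 0 < π * √3 := by positivity
  nlinarith
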